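/- If the set Y = {d_1 ∈ [0,B] : for all d_{−1} ∈ [0,B]^{n−1}, 1 ∈ X1((d_1,d_{−1}),B)} is non-empty, then Y has a maximum element (i.e., sup Y ∈ Y). -/

import Mathlib

open Finset

/-- The set of declared cost profiles lying in the box `[0,B]^n`. -/
def InBox {n : ℕ} (B : ℝ) (c : Fin n → ℝ) : Prop := ∀ i, c i ∈ Set.Icc (0:ℝ) B

/-- A set `S` of agents is budget-feasible at cost profile `c`. -/
def Feasible {n : ℕ} (B : ℝ) (c : Fin n → ℝ) (S : Finset (Fin n)) : Prop :=
  ∑ i ∈ S, c i ≤ B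

/-- The golden ratio `φ = (1 + √5)/2`. -/
noncomputable def phi : ℝ := (1 + Real.sqrt 5) / 2

open Classical in
/-- The selection rule `X1`: choose `Xge2 c` (the tie-broken optimal solution excluding
agent `0`) whenever `V (Xstar c) < φ * V (Xge2 c)`, and the tie-broken overall optimal
solution `Xstar c` otherwise. -/
noncomputable def X1 {n : ℕ} (V : Finset (Fin (n+2)) → ℝ)
    (Xstar Xge2 : (Fin (n+2) → ℝ) → Finset (Fin (n+2))) (c : Fin (n+2) → ℝ) :
    Finset (Fin (n+2)) :=
  if V (Xstar c) < phi * V (Xge2 c) then Xge2 c else Xstar c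

open Filter Topology in
/-- Sufficiently small perturbations of a cost profile in one coordinate do not create new
budget-feasible sets. -/
theorem eventually_feasible_of_feasible_update {n : ℕ} (B : ℝ) (c : Fin n → ℝ) (i : Fin n) :
    ∀ᶠ d in 𝓝 (c i), ∀ S, Feasible B (Function.update c i d) S → Feasible B c S := by
  rw [eventually_all]
  intro S
  by_cases hS : Feasible B c S
  · exact Eventually.of_forall fun _ _ => hS
  · have hcont : Continuous fun d : ℝ => ∑ j ∈ S, Function.update c i d j :=
      continuous_finsetSum S fun j _ =>
        (continuous_apply j).comp (Continuous.update (f := fun _ : ℝ => c) continuous_const i continuous_id)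
    have hlt : B < ∑ j ∈ S, Function.update c i (c i) j := by
      simpa [Feasible] using hS
    filter_upwards [hcont.continuousAt.eventually_const_lt hlt] with d hd hfeas
    exact absurd hfeas hd.not_ge

/-- Raising the cost of one agent does not create new budget-feasible sets. -/
theorem Feasible.update_of_le {n : ℕ} {B : ℝ} {c : Fin n → ℝ} {S : Finset (Fin n)}
    (h : Feasible B c S) {i : Fin n} {d : ℝ} (hd : d ≤ c i) :
    Feasible B (Function.update c i d) S := by
  refine (Finset.sum_le_sum fun j _ => ?_).trans h
  exact update_le_self_iff.mpr hd j

/-- If the set `Y` of reports of agent `0` that guarantee agent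
`0`'s selection under `X1` is non-empty, then it has a maximum element. -/
theorem Y_has_max (n : ℕ) (B : ℝ) (hB : 0 < B)
    (V : Finset (Fin (n+2)) → ℝ) (hVnonneg : ∀ S, 0 ≤ V S)
    (r : Finset (Fin (n+2)) → Finset (Fin (n+2)) → Prop)
    (hr : IsStrictTotalOrder (Finset (Fin (n+2))) r)
    (hrcard : ∀ S T : Finset (Fin (n+2)), T.card < S.card → r S T)
    (Xstar Xge2 : (Fin (n+2) → ℝ) → Finset (Fin (n+2)))
    (hXstar : ∀ c, InBox B c → Feasible B c (Xstar c) ∧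
      (∀ S, Feasible B c S → V S ≤ V (Xstar c)) ∧
      (∀ S, Feasible B c S → V S = V (Xstar c) → S ≠ Xstar c → r (Xstar c) S))
    (hXge2 : ∀ c, InBox B c → Xge2 c ⊆ Finset.univ.erase 0 ∧ Feasible B c (Xge2 c) ∧
      (∀ S ⊆ Finset.univ.erase 0, Feasible B c S → V S ≤ V (Xge2 c)) ∧
      (∀ S ⊆ Finset.univ.erase 0, Feasible B c S → V S = V (Xge2 c) → S ≠ Xge2 c →
        r (Xge2 c) S))
    (hXge2const : ∀ c c' : Fin (n+2) → ℝ, (∀ j, j ≠ 0 → c j = c' j) → Xge2 c = Xge2 c')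
    :
    ∀ Y : Set ℝ,
      Y = {d | d ∈ Set.Icc (0:ℝ) B ∧
        ∀ c : Fin (n+2) → ℝ, InBox B c → c 0 = d → (0 : Fin (n+2)) ∈ X1 V Xstar Xge2 c} →
      Y.Nonempty → sSup Y ∈ Y := by
  rintro Y rfl hne
  set Y : Set ℝ := {d | d ∈ Set.Icc (0:ℝ) B ∧
    ∀ c : Fin (n+2) → ℝ, InBox B c → c 0 = d → (0 : Fin (n+2)) ∈ X1 V Xstar Xge2 c}
  have hbdd : BddAbove Y := ⟨B, fun d hd => hd.1.2⟩
  have hlub : IsLUB Y (sSup Y) := isLUB_csSup hne hbdd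
  refine ⟨?_, fun c hc hc0 => ?_⟩
  · obtain ⟨d, hd⟩ := hne
    exact ⟨hd.1.1.trans (hlub.1 hd), hlub.2 fun d hd => hd.1.2⟩
  have hev := eventually_feasible_of_feasible_update B c 0
  rw [hc0] at hev
  obtain ⟨d, hdY, hd⟩ :=
    ((mem_closure_iff_frequently.mp (hlub.mem_closure hne)).and_eventually hev).exists
  have hdle : d ≤ c 0 := hc0 ▸ hlub.1 hdY
  set c' := Function.update c 0 d with hc'
  have hbox : InBox B c' := by
    intro j
    rcases eq_or_ne j 0 with rfl | hj
    · simpa [hc'] using hdY.1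
    · simpa [hc', hj] using hc j
  have hmem := hdY.2 c' hbox (by simp [hc'])
  have hge2 : Xge2 c' = Xge2 c := hXge2const c' c fun j hj => by simp [hc', hj]
  obtain ⟨hf, hmax, htie⟩ := hXstar c hc
  obtain ⟨hf', hmax', htie'⟩ := hXstar c' hbox
  have hV : V (Xstar c) = V (Xstar c') :=
    le_antisymm (hmax' _ (hf.update_of_le hdle)) (hmax _ (hd _ hf'))
  have hstar : Xstar c' = Xstar c := by
    by_contra hneq
    exact hr.toIsStrictOrder.toIrrefl.irrefl _ (hr.toIsStrictOrder.toIsTrans.trans _ _ _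
      (htie _ (hd _ hf') hV.symm hneq)
      (htie' _ (hf.update_of_le hdle) hV (Ne.symm hneq)))
  simpa only [X1, hstar, hge2] using hmem
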